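/- Every Lagrangian subspace of F_2^6 contains either 8 even characteristics (Fano configuration) or exactly 4 even and 4 odd characteristics (Pascal configuration); there are exactly 30 Fano configurations and 105 Pascal configurations, totaling 135 Lagrangian subspaces. -/

import Mathlib

open Finset

/-- The space of theta characteristics in genus `g`: pairs `(m', m'')` of vectors in `F_2^g`. -/
abbrev V (g : ℕ) := (Fin g → ZMod 2) × (Fin g → ZMod 2)

/-- The `F_2`-inner product of two vectors. -/
def dotp {g : ℕ} (a b : Fin g → ZMod 2) : ZMod 2 := ∑ i, a i * b i

/-- The parity invariant `m'·m'' ∈ F_2`; `m` is even iff `par m = 0`. -/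
def par {g : ℕ} (m : V g) : ZMod 2 := dotp m.1 m.2

/-- The sign `e(m) = (-1)^{m'·m''}`. -/
def e {g : ℕ} (m : V g) : ℤ := (-1) ^ (par m).val

/-- The syzygy invariant `e(m₁,m₂,m₃) = e(m₁)e(m₂)e(m₃)e(m₁+m₂+m₃)`. -/
def e3 {g : ℕ} (m₁ m₂ m₃ : V g) : ℤ := e m₁ * e m₂ * e m₃ * e (m₁ + m₂ + m₃)

/-- The standard symplectic form `⟨m,n⟩ = m'·n'' + m''·n'` on `F_2^{2g}`. -/
def sp {g : ℕ} (m n : V g) : ZMod 2 := dotp m.1 n.2 + dotp m.2 n.1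

/-- A Lagrangian subspace (Göpel system) of `F_2^6`: 3-dimensional and isotropic. -/
def IsLagrangian (L : Submodule (ZMod 2) (V 3)) : Prop :=
  Module.finrank (ZMod 2) L = 3 ∧ ∀ m ∈ L, ∀ n ∈ L, sp m n = 0

section LinearAlgebra

open Module Submodule

/-- A `k`-dimensional space over `F_q` has `∏_{i<k} (q^k - q^i)` bases, so the tuples spanning a
subspace with property `Q` count these subspaces with that multiplicity. -/
theorem card_linearIndependent_span {K W : Type*} [Field K] [Fintype K] [AddCommGroup W]
    [Module K W] [Finite W] (k : ℕ) (Q : Submodule K W → Prop) :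
    Nat.card {s : Fin k → W // LinearIndependent K s ∧ Q (span K (Set.range s))} =
      Nat.card {L : Submodule K W // finrank K L = k ∧ Q L} *
        ∏ i : Fin k, (Fintype.card K ^ k - Fintype.card K ^ i.val) := by
  classical
  let f : {s : Fin k → W // LinearIndependent K s ∧ Q (span K (Set.range s))} →
      {L : Submodule K W // finrank K L = k ∧ Q L} := fun s =>
    ⟨span K (Set.range s.1), by simpa using finrank_span_eq_card s.2.1, s.2.2⟩
  have fiber (L : {L : Submodule K W // finrank K L = k ∧ Q L}) :
      Nat.card {s // f s = L} = ∏ i : Fin k, (Fintype.card K ^ k - Fintype.card K ^ i.val) := by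
    obtain ⟨L, hk, hQ⟩ := L
    have hcard := card_linearIndependent (K := K) (V := L) (k := k) hk.ge
    rw [hk] at hcard
    rw [← hcard]
    have hspan (t : Fin k → L) (ht : LinearIndependent K t) :
        span K (Set.range fun i => (t i : W)) = L := by
      have ht' : LinearIndependent K fun i => (t i : W) :=
        ht.map' L.subtype (ker_subtype L)
      apply eq_of_le_of_finrank_eq
      · rw [span_le]
        rintro _ ⟨i, rfl⟩
        exact (t i).2
      · rw [finrank_span_eq_card ht', hk, Fintype.card_fin]
    refine Nat.card_congr
      { toFun := fun s => ⟨fun i => ⟨s.1.1 i, ?_⟩, ?_⟩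
        invFun := fun t => ⟨⟨fun i => t.1 i, ?_, ?_⟩, ?_⟩
        left_inv := fun s => rfl
        right_inv := fun t => rfl }
    · have h : span K (Set.range s.1.1) = L := congrArg Subtype.val s.2
      exact h.le (subset_span ⟨i, rfl⟩)
    · exact LinearIndependent.of_comp L.subtype s.1.2.1
    · exact t.2.map' L.subtype (ker_subtype L)
    · rwa [hspan t.1 t.2]
    · exact Subtype.ext (hspan t.1 t.2)
  have : Fintype {L : Submodule K W // finrank K L = k ∧ Q L} := Fintype.ofFinite _
  rw [← Nat.card_congr (Equiv.sigmaFiberEquiv f), Nat.card_sigma]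
  simp [fiber]

theorem linearIndependent_triple_zmod_two {W : Type*} [AddCommGroup W] [Module (ZMod 2) W]
    (a b c : W) : LinearIndependent (ZMod 2) ![c, b, a] ↔
      (a ≠ 0 ∧ b ≠ 0 ∧ b ≠ a) ∧ c ≠ 0 ∧ c ≠ a ∧ c ≠ b ∧ c ≠ a + b := by
  have hpair : LinearIndependent (ZMod 2) ![b, a] ↔ a ≠ 0 ∧ b ≠ 0 ∧ b ≠ a := by
    by_cases hb : b = 0
    · subst hb
      simpa using fun h : LinearIndependent (ZMod 2) ![0, a] => h.ne_zero 0 rfl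
    · rw [LinearIndependent.pair_iff' hb]
      have : (∀ t : ZMod 2, t • b ≠ a) ↔ (0 : ZMod 2) • b ≠ a ∧ (1 : ZMod 2) • b ≠ a :=
        Fin.forall_fin_two
      rw [this, zero_smul, one_smul]
      tauto
  have hmem : c ∈ span (ZMod 2) (Set.range ![b, a]) ↔ c = 0 ∨ c = a ∨ c = b ∨ c = a + b := by
    have h2 (p : ZMod 2 → Prop) : (∃ t, p t) ↔ p 0 ∨ p 1 := Fin.exists_fin_two
    simp only [Matrix.range_cons, Matrix.range_empty, Set.union_empty, Set.singleton_union,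
      mem_span_pair, h2, zero_smul, one_smul, add_zero, zero_add, add_comm b a]
    simp only [eq_comm (b := c)]
    tauto
  rw [show ![c, b, a] = Fin.cons c ![b, a] from rfl, linearIndependent_finCons, hpair, hmem]
  tauto

end LinearAlgebra

section Symplectic

variable {g : ℕ}

theorem dotp_comm (a b : Fin g → ZMod 2) : dotp a b = dotp b a := by
  simp [dotp, mul_comm]

theorem dotp_add_left (a b c : Fin g → ZMod 2) : dotp (a + b) c = dotp a c + dotp b c := by
  simp [dotp, add_mul, sum_add_distrib]

theorem sp_comm (m n : V g) : sp m n = sp n m := by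
  rw [sp, sp, dotp_comm m.1, dotp_comm m.2, add_comm]

theorem sp_self (m : V g) : sp m m = 0 := by
  rw [sp, dotp_comm m.2, CharTwo.add_self_eq_zero]

theorem sp_add_left (m m' n : V g) : sp (m + m') n = sp m n + sp m' n := by
  simp only [sp, Prod.fst_add, Prod.snd_add, dotp_add_left]
  ring

theorem sp_zero_left (n : V g) : sp 0 n = 0 := by
  simp [sp, dotp]

theorem sp_smul_left (t : ZMod 2) (m n : V g) : sp (t • m) n = t * sp m n := by
  simp only [sp, dotp, Prod.smul_fst, Prod.smul_snd, Pi.smul_apply, smul_eq_mul, mul_add, mul_sum,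
    mul_assoc]

theorem par_add (m n : V g) : par (m + n) = par m + par n + sp m n := by
  simp only [par, sp, dotp, Prod.fst_add, Prod.snd_add, Pi.add_apply, ← sum_add_distrib]
  exact sum_congr rfl fun i _ => by ring

theorem par_zero : par (0 : V g) = 0 := by
  simp [par, dotp]

theorem par_smul (t : ZMod 2) (m : V g) : par (t • m) = t ^ 2 * par m := by
  simp only [par, dotp, Prod.smul_fst, Prod.smul_snd, Pi.smul_apply, smul_eq_mul, mul_sum]
  exact sum_congr rfl fun i _ => by ring

theorem sp_span_eq_zero_iff (S : Set (V g)) :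
    (∀ m ∈ Submodule.span (ZMod 2) S, ∀ n ∈ Submodule.span (ZMod 2) S, sp m n = 0) ↔
      ∀ m ∈ S, ∀ n ∈ S, sp m n = 0 := by
  have extend (n : V g) (h : ∀ m ∈ S, sp m n = 0) :
      ∀ m ∈ Submodule.span (ZMod 2) S, sp m n = 0 := by
    intro m hm
    induction hm using Submodule.span_induction with
    | mem m hm => exact h m hm
    | zero => exact sp_zero_left n
    | add m m' _ _ h h' => rw [sp_add_left, h, h', add_zero]
    | smul t m _ h => rw [sp_smul_left, h, mul_zero]
  refine ⟨fun h m hm n hn => h m (Submodule.subset_span hm) n (Submodule.subset_span hn),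
    fun h m hm n hn => extend n (fun m hm => ?_) m hm⟩
  rw [sp_comm]
  exact extend m (fun n hn => h n hn m hm) n hn

theorem par_span_eq_zero_iff (S : Set (V g)) (hS : ∀ m ∈ S, ∀ n ∈ S, sp m n = 0) :
    (∀ m ∈ Submodule.span (ZMod 2) S, par m = 0) ↔ ∀ m ∈ S, par m = 0 := by
  refine ⟨fun h m hm => h m (Submodule.subset_span hm), fun h m hm => ?_⟩
  induction hm using Submodule.span_induction with
  | mem m hm => exact h m hm
  | zero => exact par_zero
  | add m n hm hn h h' =>
    rw [par_add, h, h', (sp_span_eq_zero_iff S).2 hS m hm n hn, add_zero, add_zero]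
  | smul t m _ h => rw [par_smul, h, mul_zero]

/-- On a Lagrangian subspace the parity is linear, so it vanishes identically or on a hyperplane. -/
theorem IsLagrangian.card_even {L : Submodule (ZMod 2) (V 3)} (hL : IsLagrangian L) :
    ((∀ x ∈ L, par x = 0) ∧ Nat.card {x : V 3 // x ∈ L ∧ par x = 0} = 8) ∨
      ((¬ ∀ x ∈ L, par x = 0) ∧ Nat.card {x : V 3 // x ∈ L ∧ par x = 0} = 4 ∧
        Nat.card {x : V 3 // x ∈ L ∧ par x = 1} = 4) := by
  obtain ⟨hdim, hiso⟩ := hL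
  let f : L →ₗ[ZMod 2] ZMod 2 := AddMonoidHom.toZModLinearMap 2
    { toFun := fun x => par x.1
      map_zero' := par_zero
      map_add' := fun x y => by
        rw [Submodule.coe_add, par_add, hiso x x.2 y y.2, add_zero] }
  have hf (x : L) : f x = par x.1 := rfl
  have hcardL : Nat.card L = 8 := by
    rw [Module.natCard_eq_pow_finrank (K := ZMod 2), hdim]
    simp
  have heven : Nat.card {x : V 3 // x ∈ L ∧ par x = 0} = Nat.card {x : L // f x = 0} :=
    Nat.card_congr (Equiv.subtypeSubtypeEquivSubtypeInter (· ∈ L) (par · = 0)).symm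
  have hodd : Nat.card {x : V 3 // x ∈ L ∧ par x = 1} = Nat.card {x : L // ¬ f x = 0} := by
    refine Nat.card_congr ((Equiv.subtypeSubtypeEquivSubtypeInter (· ∈ L) (par · = 1)).symm.trans
      (Equiv.subtypeEquivRight fun x => ?_))
    rw [hf]
    generalize par x.1 = t
    revert t
    decide
  have hsum : Nat.card {x : L // f x = 0} + Nat.card {x : L // ¬ f x = 0} = 8 := by
    rw [← hcardL, ← Nat.card_sum]
    classical exact Nat.card_congr (Equiv.sumCompl fun x : L => f x = 0)
  rw [heven, hodd]
  by_cases h : ∀ x ∈ L, par x = 0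
  · refine Or.inl ⟨h, ?_⟩
    rw [← hcardL]
    exact Nat.card_congr (Equiv.subtypeUnivEquiv fun x => h x x.2)
  · have hne : f ≠ 0 := fun h0 => h fun x hx => by
      rw [← hf ⟨x, hx⟩, h0, LinearMap.zero_apply]
    have hrange : Module.finrank (ZMod 2) (LinearMap.range f) = 1 := by
      rw [LinearMap.range_eq_top.2 (LinearMap.surjective hne), finrank_top, Module.finrank_self]
    have hker := LinearMap.finrank_range_add_finrank_ker f
    have hcard : Nat.card {x : L // f x = 0} = 4 := by
      change Nat.card (LinearMap.ker f) = 4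
      rw [Module.natCard_eq_pow_finrank (K := ZMod 2),
        show Module.finrank (ZMod 2) (LinearMap.ker f) = 2 by omega]
      simp
    exact Or.inr ⟨h, hcard, by omega⟩

end Symplectic

section BinaryCode

/-- The parity of the number of binary digits one of `n < 64`, read off a table. -/
def oddWeight (n : ℕ) : Bool := Nat.testBit 7608434000728254870 n

/-- The characteristic whose coordinates are the binary digits of a number below 64. -/
def decode (n : Fin 64) : V 3 :=
  (fun i => if n.val.testBit i then 1 else 0, fun i => if n.val.testBit (i + 3) then 1 else 0)

/-- Whether the symplectic form vanishes on a pair of encoded characteristics. -/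
def orthCode (m n : ℕ) : Bool := !oddWeight (m &&& ((n >>> 3) ||| ((n % 8) <<< 3)))

/-- Whether an encoded characteristic is even. -/
def evenCode (m : ℕ) : Bool := !oddWeight ((m >>> 3) &&& (m % 8))

theorem sp_decode : ∀ m n : Fin 64, sp (decode m) (decode n) = 0 ↔ orthCode m n := by
  decide +kernel

theorem par_decode : ∀ m : Fin 64, par (decode m) = 0 ↔ evenCode m := by
  decide +kernel

theorem decode_bijective : Function.Bijective decode := by
  rw [Fintype.bijective_iff_injective_and_card]
  refine ⟨fun m n h => ?_, by simp [V]⟩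
  have h1 (i : Fin 3) := congrFun (congrArg Prod.fst h) i
  have h2 (i : Fin 3) := congrFun (congrArg Prod.snd h) i
  have hz (p q : Bool) : ((if p then 1 else 0 : ZMod 2) = if q then 1 else 0) → p = q := by
    revert p q
    decide
  refine Fin.ext (Nat.eq_of_testBit_eq fun i => ?_)
  obtain hi | hi := lt_or_ge i 6
  · obtain hi' | hi' := lt_or_ge i 3
    · exact hz _ _ (h1 ⟨i, hi'⟩)
    · simpa [Nat.sub_add_cancel hi'] using hz _ _ (h2 ⟨i - 3, by omega⟩)
  · have : 2 ^ 6 ≤ 2 ^ i := Nat.pow_le_pow_right two_pos hi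
    rw [Nat.testBit_lt_two_pow (by omega), Nat.testBit_lt_two_pow (by omega)]

theorem decode_xor (m n k : Fin 64) :
    decode k = decode m + decode n ↔ k.val = m.val ^^^ n.val := by
  have hlt : m.val ^^^ n.val < 64 := Nat.xor_lt_two_pow (n := 6) m.2 n.2
  have hz (p q : Bool) : (if (p ^^ q) then 1 else 0 : ZMod 2) =
      (if p then 1 else 0) + if q then 1 else 0 := by
    revert p q
    decide
  have : decode m + decode n = decode ⟨m.val ^^^ n.val, hlt⟩ := by
    ext i <;> simp only [decode, Nat.testBit_xor, hz] <;> rfl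
  rw [this, decode_bijective.1.eq_iff, Fin.ext_iff]

theorem decode_eq_zero (k : Fin 64) : decode k = 0 ↔ k.val = 0 := by
  have : (0 : V 3) = decode 0 := by
    ext i <;> simp [decode]
  rw [this, decode_bijective.1.eq_iff, Fin.ext_iff]
  rfl

/-- The sum of the values of `p` below `n`, in a form that evaluates quickly. -/
def sumBelow (p : ℕ → ℕ) (n : ℕ) : ℕ := Nat.rec 0 (fun k s => Nat.add (p k) s) n

theorem sumBelow_eq_sum (p : ℕ → ℕ) (n : ℕ) : sumBelow p n = ∑ k : Fin n, p k := by
  rw [← sum_range]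
  induction n with
  | zero => rfl
  | succ n ih =>
    rw [sum_range_succ, ← ih]
    exact Nat.add_comm (p n) (sumBelow p n)

/-- Whether two encoded characteristics are independent and orthogonal. -/
def pairCode (a b : ℕ) : Bool :=
  !Nat.beq a 0 && !Nat.beq b 0 && !Nat.beq b a && orthCode a b

/-- Whether `c` encodes a characteristic orthogonal to those of `a` and `b`, outside their span. -/
def extendCode (a b c : ℕ) : Bool :=
  orthCode a c && orthCode b c && !Nat.beq c 0 && !Nat.beq c a && !Nat.beq c b &&
    !Nat.beq c (a ^^^ b)

/-- The number of ordered isotropic independent triples of encoded characteristics, all of them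
satisfying `p`. -/
def tripleCount (p : ℕ → Bool) : ℕ :=
  sumBelow (fun a => cond (p a) (sumBelow (fun b => cond (p b && pairCode a b)
    (sumBelow (fun c => cond (p c && extendCode a b c) 1 0) 64) 0) 64) 0) 64

theorem tripleCount_true : tripleCount (fun _ => true) = 22680 := by
  decide +kernel

theorem tripleCount_evenCode : tripleCount evenCode = 5040 := by
  decide +kernel

theorem card_isotropic_triples (P : V 3 → Prop) (p : ℕ → Bool)
    (hp : ∀ m, P (decode m) ↔ p m) :
    Nat.card {s : Fin 3 → V 3 // LinearIndependent (ZMod 2) s ∧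
      (∀ m ∈ Set.range s, ∀ n ∈ Set.range s, sp m n = 0) ∧ ∀ m ∈ Set.range s, P m} =
      tripleCount p := by
  let D := Equiv.ofBijective decode decode_bijective
  let E : Fin 64 × Fin 64 × Fin 64 ≃ (Fin 3 → V 3) :=
    { toFun := fun t => ![D t.2.2, D t.2.1, D t.1]
      invFun := fun s => (D.symm (s 2), D.symm (s 1), D.symm (s 0))
      left_inv := fun t => by simp
      right_inv := fun s => by
        ext1 i
        fin_cases i <;> simp }
  have key (t : Fin 64 × Fin 64 × Fin 64) :
      (p t.1 && (p t.2.1 && pairCode t.1 t.2.1) && (p t.2.2 && extendCode t.1 t.2.1 t.2.2)) ↔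
      LinearIndependent (ZMod 2) (E t) ∧
      (∀ m ∈ Set.range (E t), ∀ n ∈ Set.range (E t), sp m n = 0) ∧
        ∀ m ∈ Set.range (E t), P m := by
    obtain ⟨a, b, c⟩ := t
    have hE : E (a, b, c) = ![decode c, decode b, decode a] := rfl
    have hbeq (x y : ℕ) : Nat.beq x y = false ↔ ¬ x = y := by
      rw [← Nat.beq_eq, Bool.not_eq_true]
    rw [hE, linearIndependent_triple_zmod_two]
    simp only [Set.forall_mem_range, Fin.forall_fin_succ, sp_self, ne_eq,
      Matrix.cons_val_zero, Matrix.cons_val_succ, IsEmpty.forall_iff, and_true, true_and,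
      sp_comm (decode c) (decode a), sp_comm (decode c) (decode b), sp_comm (decode b) (decode a),
      sp_decode, hp, decode_xor, decode_eq_zero, decode_bijective.1.eq_iff, Fin.ext_iff, pairCode,
      extendCode, Bool.and_eq_true, Bool.not_eq_true', hbeq]
    tauto
  rw [← Nat.card_congr (E.subtypeEquiv key), Nat.card_eq_fintype_card, Fintype.card_subtype,
    card_filter, Fintype.sum_prod_type]
  simp only [Fintype.sum_prod_type, tripleCount, sumBelow_eq_sum]
  refine sum_congr rfl fun a _ => ?_
  obtain ha | ha := Bool.eq_false_or_eq_true (p a)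
  · simp only [ha, Bool.true_and, cond_true]
    refine sum_congr rfl fun b _ => ?_
    obtain hb | hb := Bool.eq_false_or_eq_true (p b && pairCode a b)
    · simp only [hb, Bool.true_and, Bool.cond_eq_ite, if_true]
    · simp [hb]
  · simp [ha]

end BinaryCode

/-- A three-dimensional space over `F_2` has 168 ordered bases. -/
theorem prod_bases :
    ∏ i : Fin 3, (Fintype.card (ZMod 2) ^ 3 - Fintype.card (ZMod 2) ^ i.val) = 168 := by
  rw [ZMod.card]
  rfl

theorem card_lagrangian : Nat.card {L : Submodule (ZMod 2) (V 3) // IsLagrangian L} = 135 := by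
  have h := card_linearIndependent_span (K := ZMod 2) (W := V 3) 3
    fun L => ∀ m ∈ L, ∀ n ∈ L, sp m n = 0
  have h' := card_isotropic_triples (fun _ => True) (fun _ => true) (by simp)
  simp only [implies_true, and_true, tripleCount_true] at h'
  simp only [sp_span_eq_zero_iff, h', prod_bases] at h
  change _ = Nat.card {L : Submodule (ZMod 2) (V 3) // IsLagrangian L} * _ at h
  omega

theorem card_lagrangian_even :
    Nat.card {L : Submodule (ZMod 2) (V 3) // IsLagrangian L ∧ ∀ x ∈ L, par x = 0} = 30 := by
  have h := card_linearIndependent_span (K := ZMod 2) (W := V 3) 3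
    fun L => (∀ m ∈ L, ∀ n ∈ L, sp m n = 0) ∧ ∀ x ∈ L, par x = 0
  have h' := card_isotropic_triples (fun m => par m = 0) evenCode par_decode
  have hiff (S : Set (V 3)) := and_congr_right (par_span_eq_zero_iff S)
  simp only [tripleCount_evenCode] at h'
  simp only [sp_span_eq_zero_iff, hiff, h', prod_bases, ← and_assoc (a := _ = 3)] at h
  change _ = Nat.card {L : Submodule (ZMod 2) (V 3) // IsLagrangian L ∧ ∀ x ∈ L, par x = 0} * _ at h
  omega

theorem fano_and_pascal_configurations :
    (∀ L : Submodule (ZMod 2) (V 3), IsLagrangian L →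
      Nat.card {x : V 3 // x ∈ L ∧ par x = 0} = 8 ∨
      (Nat.card {x : V 3 // x ∈ L ∧ par x = 0} = 4 ∧
        Nat.card {x : V 3 // x ∈ L ∧ par x = 1} = 4)) ∧
    Nat.card {L : Submodule (ZMod 2) (V 3) // IsLagrangian L ∧
      Nat.card {x : V 3 // x ∈ L ∧ par x = 0} = 8} = 30 ∧
    Nat.card {L : Submodule (ZMod 2) (V 3) // IsLagrangian L ∧
      Nat.card {x : V 3 // x ∈ L ∧ par x = 0} = 4} = 105 ∧
    Nat.card {L : Submodule (ZMod 2) (V 3) // IsLagrangian L} = 135 := by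
  have h8 (L : Submodule (ZMod 2) (V 3)) : (IsLagrangian L ∧
      Nat.card {x : V 3 // x ∈ L ∧ par x = 0} = 8) ↔ IsLagrangian L ∧ ∀ x ∈ L, par x = 0 := by
    refine and_congr_right fun hL => ?_
    obtain ⟨h, h8⟩ | ⟨h, h4, -⟩ := hL.card_even
    · exact iff_of_true h8 h
    · exact iff_of_false (by omega) h
  have h4 (L : Submodule (ZMod 2) (V 3)) : (IsLagrangian L ∧
      Nat.card {x : V 3 // x ∈ L ∧ par x = 0} = 4) ↔ IsLagrangian L ∧ ¬ ∀ x ∈ L, par x = 0 := by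
    refine and_congr_right fun hL => ?_
    obtain ⟨h, h8⟩ | ⟨h, h4, -⟩ := hL.card_even
    · exact iff_of_false (by omega) (not_not.2 h)
    · exact iff_of_true h4 h
  have hsum : Nat.card {L : Submodule (ZMod 2) (V 3) // IsLagrangian L ∧ ∀ x ∈ L, par x = 0} +
      Nat.card {L : Submodule (ZMod 2) (V 3) // IsLagrangian L ∧ ¬ ∀ x ∈ L, par x = 0} =
      Nat.card {L : Submodule (ZMod 2) (V 3) // IsLagrangian L} := by
    classical
    rw [← Nat.card_sum]
    exact Nat.card_congr ((Equiv.sumCongr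
      (Equiv.subtypeSubtypeEquivSubtypeInter IsLagrangian fun L => ∀ x ∈ L, par x = 0).symm
      (Equiv.subtypeSubtypeEquivSubtypeInter IsLagrangian fun L => ¬ ∀ x ∈ L, par x = 0).symm).trans
      (Equiv.sumCompl fun L : {L // IsLagrangian L} => ∀ x ∈ L.1, par x = 0))
  rw [card_lagrangian_even, card_lagrangian] at hsum
  simp only [h8, h4]
  exact ⟨fun L hL => hL.card_even.imp And.right And.right, card_lagrangian_even, by omega,
    card_lagrangian⟩
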